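/- arXiv:1009.4214 — 6 statements merged into one kernel-verified Lean document; each statement's English description precedes it below -/
import Mathlib

section
/- Every list produced by the APR generator is a valid r-permutation: for every multiset M over a linearly ordered type α, every natural number r, and every list l occurring in gen r M, the list l has length r and its underlying multiset is contained in M (l.toMultiset ≤ M). -/
/-- Rohl's APR permutation generator: `gen r M` lists, in the order imposed by
the linear order on `α`, all `r`-permutations of the multiset `M`. -/
def gen {α : Type*} [LinearOrder α] : ℕ → Multiset α → List (List α)
  | 0, _ => [[]]
  | (r + 1), M =>
      (M.toFinset.sort (· ≤ ·)).flatMap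
        (fun o => (gen r (M.erase o)).map (o :: ·))

/-- Every list produced by the APR generator is a valid `r`-permutation. -/
theorem gen_mem_valid {α : Type*} [LinearOrder α] (M : Multiset α) (r : ℕ)
    (l : List α) (hl : l ∈ gen r M) :
    l.length = r ∧ (↑l : Multiset α) ≤ M := by
  induction r generalizing M l with
  | zero => simp_all [gen]
  | succ r ih =>
    simp only [gen, List.mem_flatMap, Finset.mem_sort, Multiset.mem_toFinset, List.mem_map] at hl
    obtain ⟨o, ho, t, ht, rfl⟩ := hl
    obtain ⟨hlen, hle⟩ := ih (M.erase o) t ht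
    refine ⟨by simp [hlen], ?_⟩
    rw [← Multiset.cons_coe, ← Multiset.cons_erase ho]
    exact Multiset.cons_le_cons o hle
end

section
/- The APR generator produces no duplicate permutations: for every multiset M over a linearly ordered type α and every natural number r, the list of lists gen r M contains no two equal entries (it is a list with no duplicates). -/
/-- The APR generator produces no duplicate permutations. -/
theorem gen_nodup {α : Type*} [LinearOrder α] (M : Multiset α) (r : ℕ) :
    (gen r M).Nodup := by
  induction r generalizing M with
  | zero => simp [gen]
  | succ r ih =>
    rw [gen, List.nodup_flatMap]
    refine ⟨fun o _ => (ih _).map List.cons_injective, ?_⟩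
    refine (Finset.sort_nodup M.toFinset (· ≤ ·)).imp fun {a b} hab => ?_
    simp only [Function.onFun, List.disjoint_left, List.mem_map]
    rintro _ ⟨l, _, rfl⟩ ⟨l', _, h⟩
    exact hab (List.cons.inj h).1.symm
end

section
/- The APR generator produces permutations following the imposed order: for every multiset M over a linearly ordered type α and every natural number r ≥ 1, the list gen r M is strictly sorted with respect to the lexicographic order on lists induced by the order on α; that is, whenever one permutation occurs before another in gen r M, the first is lexicographically smaller than the second. -/
theorem gen_pairwise_lex_of_any_length {α : Type*} [LinearOrder α] (r : ℕ) (M : Multiset α) :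
    (gen r M).Pairwise (List.Lex (· < ·)) := by
  induction r generalizing M with
  | zero => simp [gen]
  | succ r ih =>
    rw [gen, List.pairwise_flatMap]
    refine ⟨fun o _ => ?_, M.toFinset.sortedLT_sort.pairwise.imp fun {a b} hab x hx y hy => ?_⟩
    · exact List.pairwise_map.2 ((ih (M.erase o)).imp fun h => List.Lex.cons h)
    · obtain ⟨u, -, rfl⟩ := List.mem_map.1 hx
      obtain ⟨v, -, rfl⟩ := List.mem_map.1 hy
      exact List.Lex.rel hab

/-- The APR generator outputs permutations in strictly increasing
lexicographic order (the order imposed by the linear order on `α`). -/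
theorem gen_pairwise_lex {α : Type*} [LinearOrder α] (M : Multiset α) (r : ℕ)
    (hr : 1 ≤ r) :
    (gen r M).Pairwise (List.Lex (· < ·)) := by
  exact gen_pairwise_lex_of_any_length r M
end

section
/- The APR generator is complete: for every multiset M over a linearly ordered type α, every natural number r, and every list l : List α with l.length = r and l.toMultiset ≤ M, the list l occurs in gen r M. Hence gen r M enumerates every r-permutation of M. -/
/-- Completeness: every `r`-permutation of `M` occurs in `gen r M`. -/
theorem gen_complete {α : Type*} [LinearOrder α] (M : Multiset α) (r : ℕ)
    (l : List α) (hlen : l.length = r) (hle : (↑l : Multiset α) ≤ M) :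
    l ∈ gen r M := by
  subst hlen
  induction l generalizing M with
  | nil => simp [gen]
  | cons a t ih =>
    rw [← Multiset.cons_coe] at hle
    have ha : a ∈ M := Multiset.mem_of_le hle (Multiset.mem_cons_self a _)
    have ht : (↑t : Multiset α) ≤ M.erase a := by
      simpa using Multiset.erase_le_erase a hle
    simp only [List.length_cons, gen, List.mem_flatMap, Finset.mem_sort, Multiset.mem_toFinset,
      List.mem_map]
    exact ⟨a, ha, t, ih _ ht, rfl⟩
end

section
/- The first permutation output by the APR generator is obtained by populating the result minimally: for every nonempty multiset M over a linearly ordered type α and every r with 1 ≤ r ≤ card M, the first entry of gen r M equals the list consisting of the r smallest elements of M in increasing order, i.e. the first r entries of the sorted (nondecreasing) enumeration of M; moreover this list is the lexicographically least element of the r-permutation set of M. -/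
/-- A nonempty multiset splits off a least element. -/
theorem Multiset.exists_eq_cons_forall_le {α : Type*} [LinearOrder α] {M : Multiset α}
    (hM : M ≠ 0) : ∃ a N, M = a ::ₘ N ∧ ∀ b ∈ N, a ≤ b := by
  have hsort := M.sort_eq (· ≤ ·)
  have hpair := M.pairwise_sort (· ≤ ·)
  cases h : M.sort (· ≤ ·) with
  | nil => exact absurd (by simpa [h] using hsort.symm) hM
  | cons a t =>
    rw [h] at hsort hpair
    exact ⟨a, t, hsort.symm, fun b hb => List.rel_of_pairwise_cons hpair hb⟩

/-- The sorted list of distinct elements of a multiset starts with its least element. -/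
theorem Multiset.exists_sort_toFinset_cons {α : Type*} [LinearOrder α] {a : α} {N : Multiset α}
    (h : ∀ b ∈ N, a ≤ b) : ∃ t, (a ::ₘ N).toFinset.sort (· ≤ ·) = a :: t := by
  have hmem (x : α) : x ∈ (a ::ₘ N).toFinset.sort (· ≤ ·) ↔ x = a ∨ x ∈ N := by simp
  have hpair := (a ::ₘ N).toFinset.pairwise_sort (· ≤ ·)
  cases hs : (a ::ₘ N).toFinset.sort (· ≤ ·) with
  | nil => exact absurd ((hmem a).2 (Or.inl rfl)) (by rw [hs]; exact List.not_mem_nil)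
  | cons c t =>
    rw [hs] at hpair
    simp only [hs] at hmem
    have hac : a ≤ c := ((hmem c).1 List.mem_cons_self).elim (fun e => e.ge) (h c)
    have hca : c ≤ a := (List.mem_cons.1 ((hmem a).2 (Or.inl rfl))).elim (fun e => e.ge)
      (fun ha => List.rel_of_pairwise_cons hpair ha)
    exact ⟨t, by rw [le_antisymm hac hca]⟩

theorem gen_head?_eq {α : Type*} [LinearOrder α] (r : ℕ) (M : Multiset α)
    (hr : r ≤ Multiset.card M) : (gen r M).head? = some ((M.sort (· ≤ ·)).take r) := by
  induction r generalizing M with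
  | zero => simp [gen]
  | succ r ih =>
    have hM : M ≠ 0 := by rintro rfl; simp at hr
    obtain ⟨a, N, rfl, ha⟩ := Multiset.exists_eq_cons_forall_le hM
    obtain ⟨t, ht⟩ := Multiset.exists_sort_toFinset_cons ha
    rw [Multiset.card_cons] at hr
    rw [gen, ht, Multiset.sort_cons a N _ ha, List.flatMap_cons, Multiset.erase_cons_head,
      List.head?_append, List.head?_map, ih N (by omega)]
    simp

theorem eq_take_sort_or_lex {α : Type*} [LinearOrder α] (l : List α) (M : Multiset α)
    (hl : (↑l : Multiset α) ≤ M) :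
    l = (M.sort (· ≤ ·)).take l.length ∨
      List.Lex (· < ·) ((M.sort (· ≤ ·)).take l.length) l := by
  induction l generalizing M with
  | nil => simp
  | cons b t ih =>
    have hb : b ∈ M := Multiset.mem_of_le hl (by simp)
    obtain ⟨a, N, rfl, ha⟩ := Multiset.exists_eq_cons_forall_le
      (ne_of_mem_of_not_mem' hb (Multiset.notMem_zero b))
    rw [Multiset.sort_cons a N _ ha, List.length_cons, List.take_succ_cons]
    have hab : a ≤ b := (Multiset.mem_cons.1 hb).elim (fun e => e.ge) (ha b)
    rcases hab.lt_or_eq with hlt | rfl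
    · exact Or.inr (List.Lex.rel hlt)
    · rw [← Multiset.cons_coe, Multiset.cons_le_cons_iff] at hl
      exact (ih N hl).imp (congrArg (a :: ·)) List.Lex.cons

/-- The first permutation output by the APR generator is obtained by
populating the result minimally: it consists of the `r` smallest elements of
`M` in increasing order, and it is the lexicographically least
`r`-permutation of `M`. -/
theorem gen_head_minimal {α : Type*} [LinearOrder α]
    (M : Multiset α) (hM : M ≠ 0) (r : ℕ) (h1 : 1 ≤ r)
    (h2 : r ≤ Multiset.card M) :
    (gen r M).head? = some ((M.sort (· ≤ ·)).take r) ∧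
    ∀ l : List α, l.length = r → (↑l : Multiset α) ≤ M →
      l = (M.sort (· ≤ ·)).take r ∨
        List.Lex (· < ·) ((M.sort (· ≤ ·)).take r) l := by
  refine ⟨gen_head?_eq r M h2, ?_⟩
  rintro l rfl hl
  exact eq_take_sort_or_lex l M hl
end

section
/- Correctness of the parenthesization generator APR4: for a natural number n, represent an opening bracket by true and a closing bracket by false, and define genP a b (where a is the number of remaining opening brackets and b the number of remaining closing brackets) by genP 0 0 = [[]], and otherwise genP a b = (if a ≥ 1 then the lists obtained by prepending true to each member of genP (a−1) b else []) followed by (if b ≥ 1 and b > a then the lists obtained by prepending false to each member of genP a (b−1) else []). Then genP n n contains no duplicates and its entries are exactly the lists w : List Bool of length 2n containing n trues and n falses such that in every prefix of w the number of falses is at most the number of trues (the n-parenthesizations, i.e. valid parenthesizations of n+1 factors). -/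
/-- Rohl's APR4 parenthesization generator: `genP a b` generates all ways of
laying out `a` remaining opening brackets (`true`) and `b` remaining closing
brackets (`false`), closing only when `b > a`. -/
def genP : ℕ → ℕ → List (List Bool)
  | 0, 0 => [[]]
  | a, b =>
      (if h : 1 ≤ a then (genP (a - 1) b).map (true :: ·) else []) ++
      (if h : 1 ≤ b ∧ a < b then (genP a (b - 1)).map (false :: ·) else [])
  termination_by a b => a + b
  decreasing_by all_goals omega

theorem genP_of_pos {a b : ℕ} (h : 0 < a + b) :
    genP a b = (if 1 ≤ a then (genP (a - 1) b).map (true :: ·) else []) ++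
      (if 1 ≤ b ∧ a < b then (genP a (b - 1)).map (false :: ·) else []) := by
  rw [genP.eq_2 a b (by omega)]
  simp only [dite_eq_ite]

theorem genP_nodup (a b : ℕ) : (genP a b).Nodup := by
  induction h : a + b generalizing a b with
  | zero =>
    obtain ⟨rfl, rfl⟩ : a = 0 ∧ b = 0 := by omega
    simp [genP]
  | succ m ih =>
    rw [genP_of_pos (by omega), List.nodup_append']
    refine ⟨?_, ?_, ?_⟩
    · split_ifs with ha
      · exact (ih (a - 1) b (by omega)).map List.cons_injective
      · exact List.nodup_nil
    · split_ifs with hb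
      · exact (ih a (b - 1) (by omega)).map List.cons_injective
      · exact List.nodup_nil
    · intro w hw hw'
      split_ifs at hw hw' <;> grind

theorem forall_prefix_cons_iff {α : Type*} {P : List α → Prop} {x : α} {w : List α} :
    (∀ p, p <+: x :: w → P p) ↔ P [] ∧ ∀ p, p <+: w → P (x :: p) := by
  simp only [List.prefix_cons_iff]
  grind

/-- With `b - a` brackets currently open, `genP a b` lists the completions that never close more
brackets than are open. -/
theorem mem_genP_iff {a b : ℕ} (hab : a ≤ b) (w : List Bool) :
    w ∈ genP a b ↔ w.count true = a ∧ w.count false = b ∧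
      ∀ p : List Bool, p <+: w → p.count false + a ≤ p.count true + b := by
  induction w generalizing a b with
  | nil =>
    rcases Nat.eq_zero_or_pos (a + b) with h | h
    · obtain ⟨rfl, rfl⟩ : a = 0 ∧ b = 0 := by omega
      simp [genP]
    · rw [genP_of_pos h]
      constructor
      · intro hw
        split_ifs at hw <;> simp at hw
      · rintro ⟨ha, hb, -⟩
        simp at ha hb
        omega
  | cons x w ih =>
    rw [forall_prefix_cons_iff]
    rcases Nat.eq_zero_or_pos (a + b) with h | h
    · obtain ⟨rfl, rfl⟩ : a = 0 ∧ b = 0 := by omega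
      cases x <;> simp [genP]
    rw [genP_of_pos h]
    cases x with
    | true =>
      rcases a with _ | a
      · simp
      · have key := ih (a := a) (b := b) (by omega)
        have hmem : (true :: w ∈ (if 1 ≤ a + 1 then (genP (a + 1 - 1) b).map (true :: ·) else []) ++
            (if 1 ≤ b ∧ a + 1 < b then (genP (a + 1) (b - 1)).map (false :: ·) else [])) ↔
            w ∈ genP a b := by
          split_ifs <;> simp_all
        rw [hmem, key]
        simp only [List.count_cons, List.count_nil]
        grind
    | false =>
      by_cases hlt : a < b
      · obtain ⟨b, rfl⟩ : ∃ c, b = c + 1 := ⟨b - 1, by omega⟩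
        have key := ih (a := a) (b := b) (by omega)
        have hmem : (false :: w ∈ (if 1 ≤ a then (genP (a - 1) (b + 1)).map (true :: ·) else []) ++
            (if 1 ≤ b + 1 ∧ a < b + 1 then (genP a (b + 1 - 1)).map (false :: ·) else [])) ↔
            w ∈ genP a b := by
          split_ifs <;> simp_all
        rw [hmem, key]
        simp only [List.count_cons, List.count_nil]
        grind
      · constructor
        · intro hw
          split_ifs at hw <;> simp_all
        · rintro ⟨-, -, -, hp⟩
          have := hp [] List.nil_prefix
          simp at this
          omega

/-- Correctness of APR4: `genP n n` has no duplicates and its entries are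
exactly the `n`-parenthesizations, i.e. lists of `n` `true`s (opening
brackets) and `n` `false`s (closing brackets) in which no prefix has more
`false`s than `true`s. -/
theorem genP_correct (n : ℕ) :
    (genP n n).Nodup ∧
    ∀ w : List Bool, w ∈ genP n n ↔
      w.length = 2 * n ∧ w.count true = n ∧ w.count false = n ∧
        ∀ p : List Bool, p <+: w → p.count false ≤ p.count true := by
  refine ⟨genP_nodup n n, fun w => ?_⟩
  rw [mem_genP_iff le_rfl]
  have hlen := List.count_true_add_count_false w
  simp only [Nat.add_le_add_iff_right]
  constructor
  · rintro ⟨ht, hf, hp⟩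
    exact ⟨by omega, ht, hf, hp⟩
  · rintro ⟨-, ht, hf, hp⟩
    exact ⟨ht, hf, hp⟩
end
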